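/- Let A be a finite subset of Λ \ {0} and S* a nested set in A. Then there exists a ℤ-basis of Λ adapted to S*, i.e. a ℤ-basis b of Λ such that for every B ∈ S*, b ∩ (completion of ⟨B⟩_ℤ) is a ℤ-basis of the completion of ⟨B⟩_ℤ. -/

import Mathlib

open TensorProduct

variable {Λ : Type*} [AddCommGroup Λ]

/-- The completion (saturation) `Δ̄ = {λ ∈ Λ : m • λ ∈ Δ for some m > 0}` of a sublattice. -/
def completion (Δ : Submodule ℤ Λ) : Submodule ℤ Λ where
  carrier := {x | ∃ m : ℤ, 0 < m ∧ m • x ∈ Δ}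
  zero_mem' := ⟨1, one_pos, by rw [one_smul]; exact Δ.zero_mem⟩
  add_mem' := by
    rintro a b ⟨m, hm, hma⟩ ⟨k, hk, hkb⟩
    refine ⟨m * k, mul_pos hm hk, ?_⟩
    rw [show (m * k) • (a + b) = k • (m • a) + m • (k • b) by
      rw [smul_add, mul_comm m k, mul_smul, mul_smul, smul_comm k m b]]
    exact Δ.add_mem (Δ.smul_mem _ hma) (Δ.smul_mem _ hkb)
  smul_mem' := by
    rintro c x ⟨m, hm, hmx⟩
    exact ⟨m, hm, by rw [smul_comm]; exact Δ.smul_mem c hmx⟩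

/-- The completion of the sublattice spanned by a subset `B ⊆ Λ`. -/
def zcomp (B : Set Λ) : Submodule ℤ Λ := completion (Submodule.span ℤ B)

/-- An integral decomposition of `B`: the parts (the elements of the finite family `P`)
are pairwise disjoint and nonempty, they cover `B`, and the completion of `⟨B⟩ℤ` is the
internal direct sum of the completions of the spans of the parts. -/
def IsIntegralDecomp (B : Set Λ) (P : Finset (Set Λ)) : Prop :=
  (∀ p ∈ P, p.Nonempty) ∧
  ((P : Set (Set Λ)).Pairwise fun p q => Disjoint p q) ∧
  ⋃₀ (P : Set (Set Λ)) = B ∧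
  (zcomp B = ⨆ p ∈ P, zcomp p) ∧
  iSupIndep (fun p : P => zcomp (p : Set Λ))

/-- `B` is irreducible if it admits no integral decomposition with at least two parts. -/
def IrreducibleSubset (B : Set Λ) : Prop :=
  ¬ ∃ P : Finset (Set Λ), 2 ≤ P.card ∧ IsIntegralDecomp B P

/-- The set of elements of `Λ` lying in the `ℂ`-span of `B` inside `ℂ ⊗[ℤ] Λ`. -/
def inCSpan (B : Set Λ) : Set Λ :=
  {x : Λ | (1 : ℂ) ⊗ₜ[ℤ] x ∈ Submodule.span ℂ ((fun b : Λ => (1 : ℂ) ⊗ₜ[ℤ] b) '' B)}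

/-- `B` is complete in `A` if `B = A ∩ ⟨B⟩_ℂ`. -/
def IsCompleteIn (A B : Set Λ) : Prop := B = A ∩ inCSpan B

/-- A nested set in `A`: a family of nonempty irreducible subsets of `A` such that for every
pairwise incomparable (under inclusion) finite subfamily, the union of the subfamily is
complete in `A` and the subfamily consists exactly of the parts of the integral decomposition
of the union into irreducible subsets. -/
def IsNestedIn (A : Set Λ) (S : Set (Set Λ)) : Prop :=
  (∀ B ∈ S, B.Nonempty ∧ B ⊆ A ∧ IrreducibleSubset B) ∧
  ∀ F : Finset (Set Λ), ↑F ⊆ S → F.Nonempty →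
    ((F : Set (Set Λ)).Pairwise fun p q => ¬ p ⊆ q ∧ ¬ q ⊆ p) →
    IsCompleteIn A (⋃₀ ↑F) ∧ IsIntegralDecomp (⋃₀ ↑F) F

/-- A `ℤ`-basis of `Λ` (given as a subset that is linearly independent and spans) is
adapted to `S` if for every `B ∈ S` its intersection with the completion of `⟨B⟩ℤ`
is a `ℤ`-basis of that completion. -/
def IsAdaptedBasis (b : Set Λ) (S : Set (Set Λ)) : Prop :=
  LinearIndependent ℤ ((↑) : b → Λ) ∧ Submodule.span ℤ b = ⊤ ∧
  ∀ B ∈ S, LinearIndependent ℤ ((↑) : ↥(b ∩ (zcomp B : Set Λ)) → Λ) ∧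
    Submodule.span ℤ (b ∩ (zcomp B : Set Λ)) = zcomp B

theorem le_completion (Δ : Submodule ℤ Λ) : Δ ≤ completion Δ :=
  fun x hx => ⟨1, one_pos, by rwa [one_smul]⟩

theorem completion_mono {Δ₁ Δ₂ : Submodule ℤ Λ} (h : Δ₁ ≤ Δ₂) :
    completion Δ₁ ≤ completion Δ₂ :=
  fun _ ⟨m, hm, hmx⟩ => ⟨m, hm, h hmx⟩

theorem completion_completion (Δ : Submodule ℤ Λ) :
    completion (completion Δ) = completion Δ := by
  refine le_antisymm ?_ (le_completion _)
  rintro x ⟨m, hm, k, hk, h⟩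
  exact ⟨k * m, mul_pos hk hm, by rwa [mul_smul]⟩

theorem zcomp_mono {B C : Set Λ} (h : B ⊆ C) : zcomp B ≤ zcomp C :=
  completion_mono (Submodule.span_mono h)

theorem isTorsionFree_quotient_of_completion_le {N : Submodule ℤ Λ} (hN : completion N ≤ N) :
    Module.IsTorsionFree ℤ (Λ ⧸ N) := by
  rw [Module.isTorsionFree_iff_smul_eq_zero]
  intro m y hy
  obtain ⟨x, rfl⟩ := N.mkQ_surjective y
  rw [or_iff_not_imp_left]
  intro hm
  rw [← map_smul, Submodule.mkQ_apply, Submodule.Quotient.mk_eq_zero] at hy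
  rw [Submodule.mkQ_apply, Submodule.Quotient.mk_eq_zero]
  refine hN ⟨|m|, abs_pos.2 hm, ?_⟩
  rcases abs_choice m with h | h <;> rw [h]
  · exact hy
  · rw [neg_smul]
    exact N.neg_mem hy

theorem exists_isCompl_of_completion_le [Module.Finite ℤ Λ] {N : Submodule ℤ Λ}
    (hN : completion N ≤ N) : ∃ Q : Submodule ℤ Λ, IsCompl N Q := by
  have := isTorsionFree_quotient_of_completion_le hN
  obtain ⟨g, hg⟩ := N.mkQ.exists_rightInverse_of_surjective N.range_mkQ
  have hg' (y : Λ ⧸ N) : N.mkQ (g y) = y := LinearMap.congr_fun hg y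
  refine ⟨LinearMap.range g, Submodule.disjoint_def.2 ?_, codisjoint_iff.2 ?_⟩
  · rintro _ hx ⟨y, rfl⟩
    rw [← Submodule.Quotient.mk_eq_zero, ← Submodule.mkQ_apply, hg'] at hx
    rw [hx, map_zero]
  · refine eq_top_iff.2 fun x _ => Submodule.mem_sup.2
      ⟨x - g (N.mkQ x), ?_, g (N.mkQ x), ⟨_, rfl⟩, sub_add_cancel _ _⟩
    rw [← Submodule.Quotient.mk_eq_zero, ← Submodule.mkQ_apply, map_sub, hg', sub_self]

theorem exists_linearIndepOn_span_eq [Module.Free ℤ Λ] [Module.Finite ℤ Λ]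
    (Q : Submodule ℤ Λ) : ∃ c : Set Λ, LinearIndepOn ℤ id c ∧ Submodule.span ℤ c = Q := by
  let β := Module.Free.chooseBasis ℤ Q
  refine ⟨Set.range (Q.subtype ∘ β), ?_, ?_⟩
  · exact (β.linearIndependent.map' Q.subtype Q.ker_subtype).linearIndepOn_id
  · rw [Set.range_comp, Submodule.span_image, β.span_eq, Submodule.map_subtype_top]

theorem exists_linearIndepOn_complement [Module.Free ℤ Λ] [Module.Finite ℤ Λ]
    {N P : Submodule ℤ Λ} (hN : completion N ≤ N) (hNP : N ≤ P) :
    ∃ c : Set Λ, LinearIndepOn ℤ id c ∧ Disjoint N (Submodule.span ℤ c) ∧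
      N ⊔ Submodule.span ℤ c = P := by
  obtain ⟨Q, hQ⟩ := exists_isCompl_of_completion_le hN
  obtain ⟨c, hc, hcQ⟩ := exists_linearIndepOn_span_eq (Q ⊓ P)
  refine ⟨c, hc, ?_, ?_⟩
  · rw [hcQ]
    exact hQ.disjoint.mono_right inf_le_left
  · rw [hcQ, ← sup_inf_assoc_of_le Q hNP, hQ.sup_eq_top, top_inf_eq]

theorem IsNestedIn.isIntegralDecomp_maximals {A : Set Λ} {S : Set (Set Λ)}
    (hS : IsNestedIn A S) {T F : Finset (Set Λ)} (hT : (T : Set (Set Λ)) ⊆ S)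
    (hF : ∀ B, B ∈ F ↔ Maximal (· ∈ T) B) (hne : F.Nonempty) :
    IsIntegralDecomp (⋃₀ (F : Set (Set Λ))) F := by
  refine (hS.2 F (fun B hB => hT ((hF B).1 hB).prop) hne ?_).2
  intro p hp q hq hpq
  have hp' := (hF p).1 hp
  have hq' := (hF q).1 hq
  exact ⟨fun h => hpq (hp'.eq_of_le hq'.prop h), fun h => hpq (hq'.eq_of_le hp'.prop h).symm⟩

theorem IsNestedIn.completion_iSup_zcomp_le [Module.Free ℤ Λ] {A : Set Λ} {S : Set (Set Λ)}
    (hS : IsNestedIn A S) {T : Finset (Set Λ)} (hT : (T : Set (Set Λ)) ⊆ S) :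
    completion (⨆ C ∈ T, zcomp C) ≤ ⨆ C ∈ T, zcomp C := by
  classical
  rcases T.eq_empty_or_nonempty with rfl | ⟨C₀, hC₀⟩
  · rintro x ⟨m, hm, hmx⟩
    simpa [hm.ne'] using hmx
  let F := T.filter (Maximal (· ∈ T))
  have hF : ∀ B, B ∈ F ↔ Maximal (· ∈ T) B := fun B => by
    simpa [F] using fun h : Maximal (· ∈ T) B => h.prop
  obtain ⟨D₀, -, hD₀⟩ := T.exists_le_maximal hC₀
  have hdec := hS.isIntegralDecomp_maximals hT hF ⟨D₀, (hF D₀).2 hD₀⟩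
  have heq : ⨆ C ∈ T, zcomp C = zcomp (⋃₀ (F : Set (Set Λ))) := by
    rw [hdec.2.2.2.1]
    refine le_antisymm (iSup₂_le fun C hC => ?_) (iSup₂_le fun D hD => ?_)
    · obtain ⟨D, hCD, hD⟩ := T.exists_le_maximal hC
      exact (zcomp_mono hCD).trans (le_iSup₂_of_le D ((hF D).2 hD) le_rfl)
    · exact le_iSup₂_of_le D ((hF D).1 hD).prop le_rfl
  rw [heq]
  exact (completion_completion _).le

/-- In a nested family, a maximal member meets the sum of the others only in the sum of the
members it contains. -/
theorem IsNestedIn.iSup_zcomp_inf_le {A : Set Λ} {S : Set (Set Λ)}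
    (hS : IsNestedIn A S) {T T' : Finset (Set Λ)} (hT : (T : Set (Set Λ)) ⊆ S) {B : Set Λ}
    (hB : Maximal (· ∈ T) B) (hT' : ∀ C ∈ T', C ∈ T ∧ C ≠ B)
    {N : Submodule ℤ Λ} (hNB : N ≤ zcomp B) (hN : ∀ C ∈ T', C ⊆ B → zcomp C ≤ N) :
    (⨆ C ∈ T', zcomp C) ⊓ zcomp B ≤ N := by
  classical
  let F := T.filter (Maximal (· ∈ T))
  have hF : ∀ B, B ∈ F ↔ Maximal (· ∈ T) B := fun B => by
    simpa [F] using fun h : Maximal (· ∈ T) B => h.prop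
  have hBF : B ∈ F := (hF B).2 hB
  have hdec := hS.isIntegralDecomp_maximals hT hF ⟨B, hBF⟩
  have hdisj := hdec.2.2.2.2 ⟨B, hBF⟩
  let K := ⨆ (D : F) (_ : D ≠ ⟨B, hBF⟩), zcomp (D : Set Λ)
  have hle : ⨆ C ∈ T', zcomp C ≤ N ⊔ K := by
    refine iSup₂_le fun C hC => ?_
    obtain ⟨D, hCD, hD⟩ := T.exists_le_maximal (hT' C hC).1
    by_cases hDB : D = B
    · exact (hN C hC (hDB ▸ hCD)).trans le_sup_left
    · refine (zcomp_mono hCD).trans (le_trans ?_ le_sup_right)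
      exact le_iSup₂_of_le (f := fun (D : F) (_ : D ≠ ⟨B, hBF⟩) => zcomp (D : Set Λ))
        ⟨D, (hF D).2 hD⟩ (by simpa using hDB) le_rfl
  calc (⨆ C ∈ T', zcomp C) ⊓ zcomp B ≤ (N ⊔ K) ⊓ zcomp B := inf_le_inf_right _ hle
    _ = N ⊔ K ⊓ zcomp B := sup_inf_assoc_of_le K hNB
    _ = N := by rw [hdisj.symm.eq_bot, sup_bot_eq]

theorem IsNestedIn.exists_linearIndepOn_finset [Module.Free ℤ Λ] [Module.Finite ℤ Λ]
    {A : Set Λ} {S : Set (Set Λ)} (hS : IsNestedIn A S) (T : Finset (Set Λ))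
    (hT : (T : Set (Set Λ)) ⊆ S) :
    ∃ b : Set Λ, LinearIndepOn ℤ id b ∧ Submodule.span ℤ b = ⨆ C ∈ T, zcomp C ∧
      ∀ C ∈ T, zcomp C ≤ Submodule.span ℤ (b ∩ (zcomp C : Set Λ)) := by
  classical
  induction T using Finset.strongInduction with
  | H T ih =>
  rcases T.eq_empty_or_nonempty with rfl | ⟨C₀, hC₀⟩
  · exact ⟨∅, linearIndepOn_empty _ _, by simp, by simp⟩
  obtain ⟨B, -, hB⟩ := T.exists_le_maximal hC₀
  have hsub : ((T.erase B : Finset _) : Set (Set Λ)) ⊆ S :=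
    (Finset.coe_subset.2 (T.erase_subset B)).trans hT
  obtain ⟨b, hb, hbspan, hbC⟩ := ih _ (Finset.erase_ssubset hB.prop) hsub
  let G := (T.erase B).filter (· ⊆ B)
  let N := ⨆ C ∈ G, zcomp C
  have hNB : N ≤ zcomp B := iSup₂_le fun C hC => zcomp_mono (Finset.mem_filter.1 hC).2
  have hNsat : completion N ≤ N := hS.completion_iSup_zcomp_le
    ((Finset.coe_subset.2 (Finset.filter_subset _ _)).trans hsub)
  have hN : ∀ C ∈ T.erase B, C ⊆ B → zcomp C ≤ N := fun C hC hCB =>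
    le_iSup₂_of_le (f := fun C (_ : C ∈ G) => zcomp C) C (Finset.mem_filter.2 ⟨hC, hCB⟩) le_rfl
  have hinf := hS.iSup_zcomp_inf_le hT hB
    (fun C hC => ⟨Finset.mem_of_mem_erase hC, Finset.ne_of_mem_erase hC⟩) hNB hN
  obtain ⟨c, hc, hNc, hsup⟩ := exists_linearIndepOn_complement hNsat hNB
  have hcB : Submodule.span ℤ c ≤ zcomp B := hsup ▸ le_sup_right
  have hmono (C : Set Λ) : Submodule.span ℤ (b ∩ (zcomp C : Set Λ)) ≤
      Submodule.span ℤ ((b ∪ c) ∩ (zcomp C : Set Λ)) :=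
    Submodule.span_mono (Set.inter_subset_inter_left _ Set.subset_union_left)
  have hBspan : zcomp B ≤ Submodule.span ℤ ((b ∪ c) ∩ (zcomp B : Set Λ)) := by
    rw [← hsup]
    refine sup_le (iSup₂_le fun C hC => ?_) (Submodule.span_mono fun x hx => ?_)
    · rw [hsup]
      obtain ⟨hCT, hCB⟩ := Finset.mem_filter.1 hC
      refine (hbC C hCT).trans (Submodule.span_mono ?_)
      exact Set.inter_subset_inter Set.subset_union_left (zcomp_mono hCB)
    · exact ⟨Or.inr hx, hsup.symm ▸ hcB (Submodule.subset_span hx)⟩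
  have hTsup : ⨆ C ∈ T, zcomp C = zcomp B ⊔ ⨆ C ∈ T.erase B, zcomp C := by
    rw [← Finset.iSup_insert, Finset.insert_erase hB.prop]
  refine ⟨b ∪ c, hb.union hc ?_, ?_, fun C hC => ?_⟩
  · rw [Set.image_id, Set.image_id, hbspan, Submodule.disjoint_def]
    intro x hx hxc
    exact Submodule.disjoint_def.1 hNc x (hinf ⟨hx, hcB hxc⟩) hxc
  · rw [Submodule.span_union, hbspan, hTsup]
    refine le_antisymm (sup_le le_sup_right (hcB.trans le_sup_left)) (sup_le ?_ le_sup_left)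
    rw [← hsup]
    refine sup_le_sup_right (iSup₂_le fun C hC => ?_) _
    exact le_iSup₂_of_le (f := fun C (_ : C ∈ T.erase B) => zcomp C) C
      (Finset.mem_filter.1 hC).1 le_rfl
  · by_cases hCB : C = B
    · exact hCB ▸ hBspan
    · exact (hbC C (Finset.mem_erase.2 ⟨hCB, hC⟩)).trans (hmono C)

variable [Module.Free ℤ Λ] [Module.Finite ℤ Λ]

/-- For every nested set `S` in `A` there exists a `ℤ`-basis of `Λ` adapted to `S`. -/
theorem exists_adapted_basis
    (A : Set Λ) (hAfin : A.Finite) (hA0 : (0 : Λ) ∉ A)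
    (S : Set (Set Λ)) (hS : IsNestedIn A S) :
    ∃ b : Set Λ, IsAdaptedBasis b S := by
  have hSfin : S.Finite := hAfin.finite_subsets.subset fun B hB => (hS.1 B hB).2.1
  have hT : (hSfin.toFinset : Set (Set Λ)) ⊆ S := by simp
  obtain ⟨b, hb, hbspan, hbC⟩ := hS.exists_linearIndepOn_finset hSfin.toFinset hT
  obtain ⟨c, hc, hdisj, hsup⟩ :=
    exists_linearIndepOn_complement (hS.completion_iSup_zcomp_le hT) le_top
  rw [← hbspan] at hdisj hsup
  have hbc : LinearIndepOn ℤ id (b ∪ c) := hb.union hc (by simpa using hdisj)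
  refine ⟨b ∪ c, hbc, by rw [Submodule.span_union, hsup], fun B hB => ⟨?_, ?_⟩⟩
  · exact hbc.mono Set.inter_subset_left
  · refine le_antisymm (Submodule.span_le.2 Set.inter_subset_right) ?_
    exact (hbC B (hSfin.mem_toFinset.2 hB)).trans
      (Submodule.span_mono (Set.inter_subset_inter_left _ Set.subset_union_left))
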